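/- Let ≤ be a consistent cylinder order on {0,±1}^∞ with 0^∞ < 1^∞. Then there exists σ ∈ {ρ_0, ρ_1, ρ_2, τ_{0,1}} such that, defining ⪯ on {0,1}^∞ by a ⪯ b iff σ(a) ≤ σ(b), the order ⪯ is a cylinder order on {0,1}^∞ with 0^∞ ≺ 1^∞, m^abs_≤ = σ(m_⪯), and {a ∈ M^abs_≤ : a < m^abs_≤} = {0^∞} ∪ {σ(a) : a ∈ M_⪯, a ≺ m_⪯}. -/

import Mathlib

open scoped Classical

noncomputable section

/-- The ultrametric on infinite words: `d(a,b) = 2^{-min{n ≥ 1 : a_n ≠ b_n}}`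
(words are indexed from 0 here, so position `i` corresponds to `n = i+1`). -/
noncomputable def wdist {A : Type*} [DecidableEq A] (a b : ℕ → A) : ℝ :=
  if h : ∃ n, a n ≠ b n then (2 : ℝ)⁻¹ ^ (Nat.find h + 1) else 0

/-- The tail `a_{k+1} a_{k+2} ⋯` of an infinite word. -/
def shiftn {A : Type*} (a : ℕ → A) (k : ℕ) : ℕ → A := fun n => a (n + k)

/-- The set of tails of an infinite word (including the word itself). -/
def tails {A : Type*} (a : ℕ → A) : Set (ℕ → A) := {b | ∃ k, b = shiftn a k}

/-- A cylinder order: a total order such that `a ≤ b ≤ c` implies `d(a,b) ≤ d(a,c)`. -/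
def IsCylOrder {A : Type*} [DecidableEq A] (le : (ℕ → A) → (ℕ → A) → Prop) : Prop :=
  (∀ a b, le a b ∨ le b a) ∧
  (∀ a b, le a b → le b a → a = b) ∧
  (∀ a b c, le a b → le b c → le a c) ∧
  (∀ a b c, le a b → le b c → wdist a b ≤ wdist a c)

/-- Strict comparison associated to an order relation. -/
def wlt {A : Type*} (le : (ℕ → A) → (ℕ → A) → Prop) (a b : ℕ → A) : Prop :=
  le a b ∧ a ≠ b

/-- `m` is the least upper bound of the set `s` with respect to `le`. -/
def IsSupOf {A : Type*} (le : (ℕ → A) → (ℕ → A) → Prop) (s : Set (ℕ → A))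
    (m : ℕ → A) : Prop :=
  (∀ x ∈ s, le x m) ∧ ∀ b, (∀ x ∈ s, le x b) → le m b

/-- The set `M_≤ = {s_≤(a) : a ∈ A^∞}` of sup-words. -/
def supWords {A : Type*} (le : (ℕ → A) → (ℕ → A) → Prop) : Set (ℕ → A) :=
  {m | ∃ a, IsSupOf le (tails a) m}

/-- `x` is an accumulation point of `M` in the metric `wdist`. -/
def IsAccPt' {A : Type*} [DecidableEq A] (M : Set (ℕ → A)) (x : ℕ → A) : Prop :=
  ∀ ε : ℝ, 0 < ε → ∃ y ∈ M, y ≠ x ∧ wdist x y < ε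

/-- `x` is the smallest (w.r.t. `le`) accumulation point of `M`. -/
def IsSmallestAcc {A : Type*} [DecidableEq A] (le : (ℕ → A) → (ℕ → A) → Prop)
    (M : Set (ℕ → A)) (x : ℕ → A) : Prop :=
  IsAccPt' M x ∧ ∀ y, IsAccPt' M y → le x y

/-- Membership in the cylinder given by the finite word `w`. -/
def inCyl {A : Type*} (w : List A) (a : ℕ → A) : Prop :=
  ∀ i : Fin w.length, a i.val = w.get i

/-- `[u] < [v]` for cylinders: every element of `[u]` is strictly below every element of `[v]`. -/
def cylLt {A : Type*} (le : (ℕ → A) → (ℕ → A) → Prop) (u v : List A) : Prop :=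
  ∀ a b, inCyl u a → inCyl v b → wlt le a b

/-- Infinite binary words. -/
abbrev W2 := ℕ → Bool

/-- The word `0^∞`. -/
def w0 : W2 := fun _ => false

/-- The word `1^∞`. -/
def w1 : W2 := fun _ => true

/-- The word `10^∞`. -/
def w10inf : W2 := fun n => decide (n = 0)

/-- The periodic word `w^∞` for a finite word `w`. -/
def perW (w : List Bool) : W2 := fun n => w.getD (n % w.length) false

/-- A substitution on `{0,1}`, given by the images of the two letters. -/
abbrev Sub2 := Bool → List Bool

/-- Action of a substitution on finite words. -/
def listApply (f : Sub2) (l : List Bool) : List Bool := (l.map f).flatten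

/-- Action of a (nonerasing) substitution on infinite words. -/
def subApply (f : Sub2) (a : W2) : W2 :=
  fun n => (listApply f (List.ofFn (fun i : Fin (n + 1) => a i.val))).getD n false

/-- The substitution `τ_{j,k} : 0 ↦ 10^j, 1 ↦ 10^k`. -/
def tauS (j k : ℕ) : Sub2 := fun b => true :: List.replicate (if b then k else j) false

/-- Membership in the set `S = {τ_{j,k} : 0 ≤ j < k}`. -/
def memS (f : Sub2) : Prop := ∃ j k : ℕ, j < k ∧ f = tauS j k

/-- Apply a finite composition `σ_1 ∘ ⋯ ∘ σ_n` (given as a list) to an infinite word. -/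
def applyList (L : List Sub2) (a : W2) : W2 := L.foldr subApply a

/-- Apply a finite composition `σ_1 ∘ ⋯ ∘ σ_n` (given as a list) to a finite word. -/
def listApplyL (L : List Sub2) (l : List Bool) : List Bool := L.foldr listApply l

/-- `σ_{[1,n]} = σ_1 ∘ ⋯ ∘ σ_n` applied to an infinite word, for `σ ∈ S^∞`
(indexed from 0 in Lean). -/
def compUpTo (σ : ℕ → Sub2) (n : ℕ) (a : W2) : W2 :=
  applyList (List.ofFn (fun i : Fin n => σ i.val)) a

/-- `m` is the limit word `lim_{n → ∞} σ_{[1,n]}(a)`. -/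
def IsLimitWord (σ : ℕ → Sub2) (a m : W2) : Prop :=
  ∀ ε : ℝ, 0 < ε → ∃ N : ℕ, ∀ n ≥ N, wdist (compUpTo σ n a) m < ε

/-- The symmetric alphabet `{0, ±1}`. -/
inductive T3 where
  | neg : T3
  | zer : T3
  | pos : T3
deriving DecidableEq

/-- The integer value of a letter in `{0, ±1}`. -/
def T3.toInt : T3 → ℤ
  | .neg => -1
  | .zer => 0
  | .pos => 1

/-- Negation of a letter. -/
def T3.negT : T3 → T3
  | .neg => .pos
  | .zer => .zer
  | .pos => .neg

/-- The natural order `-1 < 0 < 1` on letters. -/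
def t3lt (x y : T3) : Prop := x.toInt < y.toInt

/-- Infinite words over `{0, ±1}`. -/
abbrev W3 := ℕ → T3

/-- Letterwise negation of a word. -/
def negW (a : W3) : W3 := fun n => (a n).negT

/-- Strict lexicographic order on `{0,±1}^∞` induced by `-1 < 0 < 1`. -/
def lex3lt (a b : W3) : Prop := ∃ i : ℕ, (∀ m < i, a m = b m) ∧ t3lt (a i) (b i)

/-- Lexicographic order on `{0,±1}^∞` induced by `-1 < 0 < 1`. -/
def lex3le (a b : W3) : Prop := a = b ∨ lex3lt a b

/-- The word `0^∞` over `{0,±1}`. -/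
def zeroW3 : W3 := fun _ => T3.zer

/-- The word `1^∞` over `{0,±1}`. -/
def oneW3 : W3 := fun _ => T3.pos

/-- `abs(a) = a` if `a ≥_lex 0^∞` and `-a` otherwise. -/
noncomputable def absW (a : W3) : W3 := if lex3le zeroW3 a then a else negW a

/-- The set `{abs(a_n a_{n+1} ⋯) : n ≥ 1}`. -/
def absTails (a : W3) : Set W3 := {b | ∃ k, b = absW (shiftn a k)}

/-- The set `M^abs_≤ = {s^abs_≤(a) : a ∈ {0,±1}^∞}`, where `s^abs_≤(a)` is the least upper
bound of `{abs(a_n a_{n+1} ⋯) : n ≥ 1}` with respect to `≤`. -/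
def MAbs (le : W3 → W3 → Prop) : Set W3 := {m | ∃ a, IsSupOf le (absTails a) m}

/-- A cylinder order on `{0,±1}^∞` is consistent if for each finite word `w` either
`[w(-1)] < [w0] < [w1]` or `[w(-1)] > [w0] > [w1]`. -/
def Consistent (le : W3 → W3 → Prop) : Prop :=
  ∀ w : List T3,
    (cylLt le (w ++ [T3.neg]) (w ++ [T3.zer]) ∧ cylLt le (w ++ [T3.zer]) (w ++ [T3.pos])) ∨
    (cylLt le (w ++ [T3.pos]) (w ++ [T3.zer]) ∧ cylLt le (w ++ [T3.zer]) (w ++ [T3.neg]))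

/-- Image of a letter under a `ρ`-map: letter `0 ↦ e` and letter `1 ↦ e0`, where the
sign `e` is `1` if the parity bit is `true` and `-1` otherwise. -/
def rhoImg (e : Bool) (b : Bool) : List T3 :=
  (if e then T3.pos else T3.neg) :: (if b then [T3.zer] else [])

/-- The `ρ`-map on finite words determined by a parity function `par` (where `par w`
is `true` when the relevant count of `w` is even). -/
def rhoL (par : List Bool → Bool) (l : List Bool) : List T3 :=
  (List.ofFn (fun i : Fin l.length => rhoImg (par (l.take i.val)) (l.get i))).flatten

/-- The extension of a `ρ`-map to infinite words (as the limit of its values on prefixes). -/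
def rhoW (par : List Bool → Bool) (a : W2) : W3 :=
  fun n => (rhoL par (List.ofFn (fun i : Fin (n + 1) => a i.val))).getD n T3.zer

/-- Parity for `ρ_0`: evenness of the number of 0's. -/
def par0 : List Bool → Bool := fun w => decide (Even (w.count false))

/-- Parity for `ρ_1`: evenness of the number of 1's. -/
def par1 : List Bool → Bool := fun w => decide (Even (w.count true))

/-- Parity for `ρ_2`: evenness of the length. -/
def par2 : List Bool → Bool := fun w => decide (Even w.length)

/-- The substitution `τ_{0,1} : 0 ↦ 1, 1 ↦ 10` viewed with values in `{0,±1}`. -/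
def tau01T : Bool → List T3 := fun b => if b then [T3.pos, T3.zer] else [T3.pos]

/-- Action on infinite words of a substitution from `{0,1}` to `{0,±1}`-words. -/
def subApply3 (f : Bool → List T3) (a : W2) : W3 :=
  fun n => ((List.ofFn (fun i : Fin (n + 1) => a i.val)).map f).flatten.getD n T3.zer

/-- The set of maps `{ρ_0, ρ_1, ρ_2, τ_{0,1}}` from `{0,1}^∞` to `{0,±1}^∞`. -/
def sigmaSet : Set (W2 → W3) := {rhoW par0, rhoW par1, rhoW par2, subApply3 tau01T}

/-! ### Words agreeing on a prefix -/

section CylinderOrders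

variable {A : Type*}

/-- The words `a` and `b` have the same prefix of length `n`. -/
def Agree (n : ℕ) (a b : ℕ → A) : Prop := ∀ i < n, a i = b i

theorem Agree.symm {n : ℕ} {a b : ℕ → A} (h : Agree n a b) : Agree n b a :=
  fun i hi => (h i hi).symm

theorem Agree.trans {n : ℕ} {a b c : ℕ → A} (h : Agree n a b) (h' : Agree n b c) :
    Agree n a c := fun i hi => (h i hi).trans (h' i hi)

theorem Agree.mono {m n : ℕ} {a b : ℕ → A} (h : Agree n a b) (hmn : m ≤ n) : Agree m a b :=
  fun i hi => h i (hi.trans_le hmn)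

theorem Agree.shift {n : ℕ} {a b : ℕ → A} (k : ℕ) (h : Agree (n + k) a b) :
    Agree n (shiftn a k) (shiftn b k) := fun i hi => h (i + k) (by omega)

theorem eq_of_forall_agree {a b : ℕ → A} (h : ∀ n, Agree n a b) : a = b :=
  funext fun n => h (n + 1) n n.lt_succ_self

theorem shiftn_shiftn (a : ℕ → A) (j k : ℕ) : shiftn (shiftn a j) k = shiftn a (k + j) := by
  funext n
  simp only [shiftn, Nat.add_assoc]

theorem shiftn_zero (a : ℕ → A) : shiftn a 0 = a := rfl

theorem isOpen_of_forall_agree [TopologicalSpace A] [DiscreteTopology A] {s : Set (ℕ → A)}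
    (h : ∀ x ∈ s, ∃ n, ∀ y, Agree n x y → y ∈ s) : IsOpen s := by
  rw [isOpen_iff_mem_nhds]
  intro x hx
  obtain ⟨n, hn⟩ := h x hx
  refine Filter.mem_of_superset
    ((PiNat.isOpen_cylinder (fun _ : ℕ => A) x n).mem_nhds (PiNat.self_mem_cylinder x n)) ?_
  exact fun y hy => hn y fun i hi => (hy i hi).symm

theorem exists_agree_of_mem_closure [TopologicalSpace A] [DiscreteTopology A]
    {s : Set (ℕ → A)} {x : ℕ → A} (hx : x ∈ closure s) (n : ℕ) : ∃ y ∈ s, Agree n x y := by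
  obtain ⟨y, hy, hys⟩ := mem_closure_iff.1 hx _ (PiNat.isOpen_cylinder (fun _ : ℕ => A) x n)
    (PiNat.self_mem_cylinder x n)
  exact ⟨y, hys, fun i hi => (hy i hi).symm⟩

theorem tails_nonempty (a : ℕ → A) : (tails a).Nonempty := ⟨a, 0, rfl⟩

variable [DecidableEq A]

theorem wdist_lt_iff {a b : ℕ → A} {n : ℕ} : wdist a b < (2 : ℝ)⁻¹ ^ n ↔ Agree n a b := by
  unfold wdist
  split_ifs with h
  · rw [pow_lt_pow_iff_right_of_lt_one₀ (by norm_num) (by norm_num), Nat.lt_succ_iff,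
      Nat.le_find_iff]
    simp [Agree]
  · push Not at h
    exact ⟨fun _ i _ => h i, fun _ => by positivity⟩

theorem wdist_le_wdist_iff {a b c : ℕ → A} :
    wdist a b ≤ wdist a c ↔ ∀ n, Agree n a c → Agree n a b := by
  refine ⟨fun h n hn => wdist_lt_iff.1 (h.trans_lt (wdist_lt_iff.2 hn)), fun h => ?_⟩
  by_contra! hlt
  by_cases hab : ∃ n, a n ≠ b n
  · have hval : wdist a b = (2 : ℝ)⁻¹ ^ (Nat.find hab + 1) := by simp only [wdist, dif_pos hab]
    rw [hval] at hlt
    exact Nat.find_spec hab (h _ (wdist_lt_iff.1 hlt) _ (Nat.lt_succ_self _))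
  · have hval : wdist a b = 0 := by simp only [wdist, dif_neg hab]
    have hnonneg : 0 ≤ wdist a c := by
      unfold wdist
      split_ifs <;> positivity
    linarith

theorem isAccPt'_iff {M : Set (ℕ → A)} {x : ℕ → A} :
    IsAccPt' M x ↔ ∀ n, ∃ y ∈ M, y ≠ x ∧ Agree n x y := by
  constructor
  · intro h n
    obtain ⟨y, hy, hne, hlt⟩ := h ((2 : ℝ)⁻¹ ^ n) (by positivity)
    exact ⟨y, hy, hne, wdist_lt_iff.1 hlt⟩
  · intro h ε hε
    obtain ⟨n, hn⟩ := exists_pow_lt_of_lt_one hε (by norm_num : (2 : ℝ)⁻¹ < 1)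
    obtain ⟨y, hy, hne, ha⟩ := h n
    exact ⟨y, hy, hne, (wdist_lt_iff.2 ha).trans hn⟩

/-! ### Cylinder orders -/

variable {le : (ℕ → A) → (ℕ → A) → Prop}

theorem IsCylOrder.refl (h : IsCylOrder le) (a : ℕ → A) : le a a := (h.1 a a).elim id id

theorem IsCylOrder.agree (h : IsCylOrder le) {a b c : ℕ → A} (hab : le a b) (hbc : le b c)
    {n : ℕ} (hn : Agree n a c) : Agree n a b :=
  wdist_le_wdist_iff.1 (h.2.2.2 a b c hab hbc) n hn

theorem IsCylOrder.flip (h : IsCylOrder le) : IsCylOrder (fun a b => le b a) :=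
  ⟨fun a b => h.1 b a, fun a b hab hba => h.2.1 a b hba hab,
    fun a b c hab hbc => h.2.2.1 c b a hbc hab, fun _ _ _ hab hbc =>
      wdist_le_wdist_iff.2 fun _ hn => hn.trans (h.agree hbc hab hn.symm)⟩

theorem IsCylOrder.wlt_of_not_le (h : IsCylOrder le) {a b : ℕ → A} (hab : ¬ le a b) :
    wlt le b a :=
  ⟨(h.1 a b).resolve_left hab, fun he => hab (he ▸ h.refl b)⟩

theorem IsCylOrder.not_le_of_wlt (h : IsCylOrder le) {a b : ℕ → A} (hab : wlt le a b) :
    ¬ le b a := fun hba => hab.2 (h.2.1 a b hab.1 hba)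

theorem IsCylOrder.isSupOf_unique (h : IsCylOrder le) {s : Set (ℕ → A)} {x y : ℕ → A}
    (hx : IsSupOf le s x) (hy : IsSupOf le s y) : x = y :=
  h.2.1 x y (hx.2 y hy.1) (hy.2 x hx.1)

section Compactness

variable [TopologicalSpace A] [DiscreteTopology A]

theorem IsCylOrder.isClosed_ge (h : IsCylOrder le) (x : ℕ → A) : IsClosed {y | le x y} := by
  rw [← isOpen_compl_iff]
  refine isOpen_of_forall_agree fun y hy => ?_
  by_contra! hcon
  refine hy ?_
  have hlt := h.wlt_of_not_le hy
  have hyx : y = x := eq_of_forall_agree fun n => by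
    obtain ⟨z, hyz, hz⟩ := hcon n
    exact h.agree hlt.1 (not_not.1 hz) hyz
  exact hyx ▸ h.refl y

variable [Finite A]

theorem IsCylOrder.exists_max (h : IsCylOrder le) {K : Set (ℕ → A)} (hK : IsClosed K)
    (hne : K.Nonempty) : ∃ m ∈ K, ∀ x ∈ K, le x m := by
  have key : (K ∩ ⋂ i : K, {y | le i.1 y}).Nonempty := by
    refine hK.isCompact.inter_iInter_nonempty _ (fun i => h.isClosed_ge i.1) fun u => ?_
    induction u using Finset.induction_on with
    | empty => simpa using hne
    | insert a u _ ih =>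
      obtain ⟨y, hyK, hy⟩ := ih
      simp only [Set.mem_iInter, Set.mem_ofPred_eq] at hy
      rcases h.1 a.1 y with hay | hya
      · refine ⟨y, hyK, ?_⟩
        simp only [Set.mem_iInter, Set.mem_ofPred_eq, Finset.mem_insert]
        rintro i (rfl | hi)
        exacts [hay, hy i hi]
      · refine ⟨a.1, a.2, ?_⟩
        simp only [Set.mem_iInter, Set.mem_ofPred_eq, Finset.mem_insert]
        rintro i (rfl | hi)
        exacts [h.refl _, h.2.2.1 _ _ _ (hy i hi) hya]
  obtain ⟨m, hm, hmax⟩ := key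
  exact ⟨m, hm, fun x hx => Set.mem_iInter.1 hmax ⟨x, hx⟩⟩

theorem IsCylOrder.exists_isSupOf (h : IsCylOrder le) {s : Set (ℕ → A)} (hs : s.Nonempty) :
    ∃ m ∈ closure s, IsSupOf le s m := by
  obtain ⟨m, hm, hmax⟩ := h.exists_max isClosed_closure hs.closure
  exact ⟨m, hm, fun x hx => hmax x (subset_closure hx),
    fun b hb => closure_minimal (t := {y | le y b}) hb (h.flip.isClosed_ge b) hm⟩

theorem IsCylOrder.mem_closure_of_isSupOf (h : IsCylOrder le) {s : Set (ℕ → A)}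
    (hs : s.Nonempty) {m : ℕ → A} (hm : IsSupOf le s m) : m ∈ closure s := by
  obtain ⟨m', hm', hsup⟩ := h.exists_isSupOf hs
  exact h.isSupOf_unique hm hsup ▸ hm'

end Compactness

end CylinderOrders

theorem isClosed_setOf_isAccPt' {A : Type*} [DecidableEq A] [TopologicalSpace A]
    [DiscreteTopology A] (M : Set (ℕ → A)) : IsClosed {x | IsAccPt' M x} := by
  rw [← isOpen_compl_iff]
  refine isOpen_of_forall_agree fun x hx => ?_
  by_contra! hcon
  refine hx (isAccPt'_iff.2 fun n => ?_)
  by_cases hxM : x ∈ M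
  · obtain ⟨y, hxy, hy⟩ := hcon n
    have hyacc := isAccPt'_iff.1 (not_not.1 hy)
    by_cases hyx : y = x
    · obtain ⟨z, hz, hne, hag⟩ := hyacc n
      exact ⟨z, hz, hyx ▸ hne, hyx ▸ hag⟩
    · obtain ⟨k, hk⟩ := Function.ne_iff.1 hyx
      obtain ⟨z, hz, -, hag⟩ := hyacc (max n (k + 1))
      refine ⟨z, hz, ?_, hxy.trans (hag.mono (le_max_left _ _))⟩
      rintro rfl
      exact hk (hag k (by omega))
  · obtain ⟨y, hxy, hy⟩ := hcon n
    obtain ⟨z, hz, -, hag⟩ := isAccPt'_iff.1 (not_not.1 hy) n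
    exact ⟨z, hz, fun he => hxM (he ▸ hz), hxy.trans hag⟩

/-! ### The smallest accumulation point of the sup-words on `{0,1}` -/

theorem IsCylOrder.eventually_eq_of_isSupOf_tails {le : W2 → W2 → Prop} (h : IsCylOrder le)
    {a m : W2} {n : ℕ} {c : Bool} (hc : ∀ i ≥ n, a i = c) (hm : IsSupOf le (tails a) m) :
    ∀ i ≥ n, m i = c := by
  have hfin : (tails a).Finite := by
    refine ((Set.finite_Iic n).image (shiftn a)).subset ?_
    rintro _ ⟨k, rfl⟩
    refine ⟨min k n, Set.mem_Iic.2 (min_le_right _ _), funext fun i => ?_⟩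
    rcases le_total k n with hkn | hkn
    · rw [min_eq_left hkn]
    · simp only [shiftn, min_eq_right hkn, hc (i + n) (by omega), hc (i + k) (by omega)]
  have hmem := h.mem_closure_of_isSupOf (tails_nonempty a) hm
  rw [hfin.isClosed.closure_eq] at hmem
  obtain ⟨k, rfl⟩ := hmem
  exact fun i hi => hc _ (by omega)

theorem IsCylOrder.exists_isAccPt' {le : W2 → W2 → Prop} (h : IsCylOrder le) :
    ∃ z, IsAccPt' (supWords le) z := by
  obtain ⟨z, -, hz⟩ := h.exists_max isClosed_univ Set.univ_nonempty
  obtain ⟨c, hc⟩ : ∃ c, ∀ n, ∃ i ≥ n, z i ≠ c := by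
    by_contra! hcon
    obtain ⟨n, hn⟩ := hcon false
    obtain ⟨k, hk⟩ := hcon true
    have h1 := hn (max n k) (le_max_left _ _)
    rw [hk (max n k) (le_max_right _ _)] at h1
    exact absurd h1 (by decide)
  refine ⟨z, isAccPt'_iff.2 fun n => ?_⟩
  let a : W2 := fun i => if i < n then z i else c
  have haz : Agree n a z := fun i hi => if_pos hi
  have hac : ∀ i ≥ n, a i = c := fun i hi => if_neg (by omega)
  obtain ⟨m, -, hm⟩ := h.exists_isSupOf (tails_nonempty a)
  refine ⟨m, ⟨a, hm⟩, ?_, haz.symm.trans (h.agree (hm.1 a ⟨0, rfl⟩) (hz m trivial) haz)⟩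
  rintro rfl
  obtain ⟨i, hi, hne⟩ := hc n
  exact hne (h.eventually_eq_of_isSupOf_tails hac hm i hi)

theorem IsCylOrder.exists_isSmallestAcc {le : W2 → W2 → Prop} (h : IsCylOrder le) :
    ∃ m, IsSmallestAcc le (supWords le) m := by
  obtain ⟨z, hz⟩ := h.exists_isAccPt'
  obtain ⟨m, hm, hmin⟩ := h.flip.exists_max (isClosed_setOf_isAccPt' (supWords le)) ⟨z, hz⟩
  exact ⟨m, hm, hmin⟩

/-! ### Signs and absolute values of words over `{0,±1}` -/

/-- The letter `x`, negated if `c` is true. -/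
def signedLetter (c : Bool) (x : T3) : T3 := if c then x.negT else x

/-- The word `w`, negated if `c` is true. -/
def signed (c : Bool) (w : W3) : W3 := fun n => signedLetter c (w n)

theorem signedLetter_ne_zer (c : Bool) {x : T3} (hx : x ≠ T3.zer) :
    signedLetter c x ≠ T3.zer := by
  cases c <;> cases x <;> simp_all [signedLetter, T3.negT]

theorem signedLetter_zer (c : Bool) : signedLetter c T3.zer = T3.zer := by
  cases c <;> rfl

theorem signed_signed (c d : Bool) (w : W3) : signed c (signed d w) = signed (c ^^ d) w := by
  funext n
  cases c <;> cases d <;> cases h : w n <;> simp [signed, signedLetter, T3.negT, h]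

theorem signed_false (w : W3) : signed false w = w := rfl

theorem shiftn_signed (c : Bool) (w : W3) (k : ℕ) :
    shiftn (signed c w) k = signed c (shiftn w k) := rfl

theorem Agree.signed {n : ℕ} {u v : W3} (h : Agree n u v) (c : Bool) :
    Agree n (signed c u) (signed c v) := fun i hi => congrArg (signedLetter c) (h i hi)

theorem Agree.of_signed {n : ℕ} {u v : W3} {c : Bool}
    (h : Agree n (_root_.signed c u) (_root_.signed c v)) : Agree n u v := by
  simpa [signed_signed, signed_false] using h.signed c

theorem absW_of_ne_zer {w : W3} (hw : w 0 ≠ T3.zer) :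
    absW w = signed (decide (w 0 = T3.neg)) w := by
  cases h : w 0 with
  | zer => exact absurd h hw
  | pos =>
    have hlex : lex3le zeroW3 w :=
      Or.inr ⟨0, fun m hm => absurd hm (by omega), by simp [t3lt, zeroW3, T3.toInt, h]⟩
    rw [absW, if_pos hlex]
    rfl
  | neg =>
    have hlex : ¬ lex3le zeroW3 w := by
      rintro (he | ⟨i, hi, hlt⟩)
      · simp [← he, zeroW3] at h
      · rcases Nat.eq_zero_or_pos i with rfl | hpos
        · simp [t3lt, zeroW3, T3.toInt, h] at hlt
        · have := hi 0 hpos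
          simp [zeroW3, h] at this
    rw [absW, if_neg hlex]
    rfl

theorem absW_of_pos {w : W3} (hw : w 0 = T3.pos) : absW w = w := by
  rw [absW_of_ne_zer (by simp [hw]), hw]
  rfl

theorem absW_apply_zero_of_ne_zer {w : W3} (hw : w 0 ≠ T3.zer) : absW w 0 = T3.pos := by
  rw [absW_of_ne_zer hw]
  cases h : w 0 <;> simp_all [signed, signedLetter, T3.negT]

theorem absW_apply_zero_of_zer {w : W3} (hw : w 0 = T3.zer) : absW w 0 = T3.zer := by
  unfold absW
  split_ifs <;> simp [negW, hw, T3.negT]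

theorem absW_signed {w : W3} (c : Bool) (hw : w 0 ≠ T3.zer) : absW (signed c w) = absW w := by
  rw [absW_of_ne_zer hw, absW_of_ne_zer (signedLetter_ne_zer c hw), signed_signed]
  congr 1
  cases c <;> cases h : w 0 <;> simp_all [signed, signedLetter, T3.negT]

theorem Agree.absW {n : ℕ} {u v : W3} (h : Agree (n + 1) u v) (hu : u 0 ≠ T3.zer) :
    Agree (n + 1) (absW u) (absW v) := by
  have h0 : u 0 = v 0 := h 0 n.succ_pos
  rw [absW_of_ne_zer hu, absW_of_ne_zer (h0 ▸ hu), h0]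
  exact h.signed _

theorem absW_zeroW3 : absW zeroW3 = zeroW3 := if_pos (Or.inl rfl)

/-! ### Signed block codes -/

/-- The map `σ` replaces each letter `0` by a block `e` and each letter `1` by a block `e0` with
`e = ±1`, where `e = 1` in the first block and the sign changes after the block of a letter `b`
if and only if `f b` is true. -/
structure IsSignedCode (f : Bool → Bool) (σ : W2 → W3) : Prop where
  head (t : W2) : σ t 0 = T3.pos
  short (t : W2) (h : t 0 = false) : shiftn (σ t) 1 = signed (f false) (σ (shiftn t 1))
  sep (t : W2) (h : t 0 = true) : σ t 1 = T3.zer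
  long (t : W2) (h : t 0 = true) : shiftn (σ t) 2 = signed (f true) (σ (shiftn t 1))

/-- The words `v` in the cylinders `[1 x]` and `[1 0 y]`, where `x` and `y` are the signs following
the blocks `1` and `10` in a signed block code. -/
def IsLow (f : Bool → Bool) (v : W3) : Prop :=
  v 0 = T3.pos ∧ (v 1 = signedLetter (f false) T3.pos ∨
    v 1 = T3.zer ∧ v 2 = signedLetter (f true) T3.pos)

theorem IsLow.congr {f : Bool → Bool} {u v : W3} (hu : IsLow f u) (h : Agree 3 u v) :
    IsLow f v := by
  have h0 := h 0 (by omega)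
  have h1 := h 1 (by omega)
  have h2 := h 2 (by omega)
  rwa [IsLow, ← h0, ← h1, ← h2]

/-- Every tail of `w` starting with a nonzero letter has its absolute value in the cylinders
of `IsLow`, and `w` starts with `1`. -/
def IsDecodable (f : Bool → Bool) (w : W3) : Prop :=
  w 0 = T3.pos ∧ ∀ k, w k ≠ T3.zer → IsLow f (absW (shiftn w k))

/-- The word obtained by removing the first block and normalizing the sign. -/
def dropBlock (w : W3) : W3 := if w 1 = T3.zer then absW (shiftn w 2) else absW (shiftn w 1)

/-- The sequence of blocks of a word over `{0,±1}`. -/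
def decode (w : W3) : W2 := fun n => decide ((dropBlock^[n] w) 1 = T3.zer)

theorem shiftn_decode (w : W3) : shiftn (decode w) 1 = decode (dropBlock w) := rfl

theorem IsDecodable.isLow {f : Bool → Bool} {w : W3} (h : IsDecodable f w) : IsLow f w := by
  have := h.2 0 (by simp [h.1])
  rwa [shiftn_zero, absW_of_pos h.1] at this

theorem IsDecodable.absW_shiftn {f : Bool → Bool} {w : W3} (h : IsDecodable f w) {k : ℕ}
    (hk : w k ≠ T3.zer) : IsDecodable f (absW (shiftn w k)) := by
  have hk' : shiftn w k 0 ≠ T3.zer := by simpa [shiftn] using hk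
  refine ⟨absW_apply_zero_of_ne_zer hk', fun j hj => ?_⟩
  have hj' : w (j + k) ≠ T3.zer := by
    intro h0
    rw [absW_of_ne_zer hk'] at hj
    simp [signed, shiftn, h0, signedLetter_zer] at hj
  rw [absW_of_ne_zer hk', shiftn_signed, shiftn_shiftn, absW_signed]
  · exact h.2 _ hj'
  · simpa [shiftn] using hj'

theorem signed_absW {w : W3} {c : Bool} (hw : w 0 = signedLetter c T3.pos) :
    signed c (absW w) = w := by
  have hne : w 0 ≠ T3.zer := hw ▸ signedLetter_ne_zer c (by simp)
  have hd : decide (w 0 = T3.neg) = c := by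
    cases c <;> simp [hw, signedLetter, T3.negT]
  rw [absW_of_ne_zer hne, signed_signed, hd, Bool.xor_self, signed_false]

namespace IsSignedCode

variable {f : Bool → Bool} {σ : W2 → W3}

theorem isLow (hσ : IsSignedCode f σ) (t : W2) : IsLow f (σ t) := by
  refine ⟨hσ.head t, ?_⟩
  cases h : t 0 with
  | false =>
    left
    have := congrFun (hσ.short t h) 0
    simpa [shiftn, signed, hσ.head] using this
  | true =>
    right
    have := congrFun (hσ.long t h) 0
    exact ⟨hσ.sep t h, by simpa [shiftn, signed, hσ.head] using this⟩

theorem apply_one_eq_zer_iff (hσ : IsSignedCode f σ) (t : W2) :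
    σ t 1 = T3.zer ↔ t 0 = true := by
  refine ⟨fun h => ?_, hσ.sep t⟩
  by_contra hf
  have := congrFun (hσ.short t (by simpa using hf)) 0
  simp only [shiftn, signed, zero_add, hσ.head] at this
  exact signedLetter_ne_zer _ (by simp) (this.symm.trans h)

/-- The length of the prefix of `σ t` that is determined by the prefix of `t` of length `n`. -/
def prefixLength : ℕ → W2 → ℕ
  | 0, _ => 1
  | n + 1, t => prefixLength n (shiftn t 1) + (if t 0 then 2 else 1)

theorem le_prefixLength (n : ℕ) (t : W2) : n + 1 ≤ prefixLength n t := by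
  induction n generalizing t with
  | zero => exact le_rfl
  | succ n ih =>
    have := ih (shiftn t 1)
    rw [prefixLength]
    split_ifs <;> omega

theorem prefixLength_le (n : ℕ) (t : W2) : prefixLength n t ≤ 2 * n + 1 := by
  induction n generalizing t with
  | zero => exact le_rfl
  | succ n ih =>
    have := ih (shiftn t 1)
    rw [prefixLength]
    split_ifs <;> omega

theorem agree_apply (hσ : IsSignedCode f σ) {n : ℕ} {s t : W2} (h : Agree n s t) :
    Agree (prefixLength n s) (σ s) (σ t) := by
  induction n generalizing s t with
  | zero =>
    intro i hi
    obtain rfl : i = 0 := by simpa [prefixLength] using hi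
    rw [hσ.head, hσ.head]
  | succ n ih =>
    have hst : s 0 = t 0 := h 0 n.succ_pos
    have htail := (ih (h.shift 1)).signed
    rw [prefixLength]
    rintro (_ | i) hi
    · rw [hσ.head, hσ.head]
    cases hs : s 0 with
    | false =>
      have := htail (f false)
      rw [← hσ.short s hs, ← hσ.short t (hst ▸ hs)] at this
      exact this i (by simp [hs] at hi; omega)
    | true =>
      have := htail (f true)
      rw [← hσ.long s hs, ← hσ.long t (hst ▸ hs)] at this
      rcases i with _ | i
      · rw [hσ.sep s hs, hσ.sep t (hst ▸ hs)]
      · exact this i (by simp [hs] at hi; omega)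

theorem agree_of_agree_apply (hσ : IsSignedCode f σ) {n : ℕ} {s t : W2}
    (h : Agree (prefixLength n s) (σ s) (σ t)) : Agree n s t := by
  induction n generalizing s t with
  | zero => exact fun i hi => absurd hi (by omega)
  | succ n ih =>
    have hlen := le_prefixLength (n + 1) s
    have hst : s 0 = t 0 := by
      rw [Bool.eq_iff_iff, ← hσ.apply_one_eq_zer_iff, ← hσ.apply_one_eq_zer_iff,
        h 1 (by omega)]
    rw [prefixLength] at h
    have htail : Agree n (shiftn s 1) (shiftn t 1) := by
      refine ih ?_
      cases hs : s 0 with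
      | false =>
        rw [if_neg (by simp [hs])] at h
        have := h.shift 1
        rw [hσ.short s hs, hσ.short t (hst ▸ hs)] at this
        exact this.of_signed
      | true =>
        rw [if_pos hs] at h
        have := h.shift 2
        rw [hσ.long s hs, hσ.long t (hst ▸ hs)] at this
        exact this.of_signed
    rintro (_ | i) hi
    · exact hst
    · exact htail i (by omega)

theorem agree_apply_of_agree (hσ : IsSignedCode f σ) {n : ℕ} {s t : W2} (h : Agree n s t) :
    Agree n (σ s) (σ t) :=
  (hσ.agree_apply h).mono ((Nat.le_succ n).trans (le_prefixLength n s))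

theorem injective (hσ : IsSignedCode f σ) : Function.Injective σ := fun _ _ h =>
  eq_of_forall_agree fun _ => hσ.agree_of_agree_apply (h ▸ fun _ _ => rfl)

theorem isCylOrder (hσ : IsSignedCode f σ) {le : W3 → W3 → Prop} (h : IsCylOrder le) :
    IsCylOrder fun a b => le (σ a) (σ b) :=
  ⟨fun _ _ => h.1 _ _, fun _ _ hab hba => hσ.injective (h.2.1 _ _ hab hba),
    fun _ _ _ hab hbc => h.2.2.1 _ _ _ hab hbc, fun _ _ _ hab hbc =>
      wdist_le_wdist_iff.2 fun _ hn =>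
        hσ.agree_of_agree_apply (h.agree hab hbc (hσ.agree_apply hn))⟩

theorem absW_shiftn_apply (hσ : IsSignedCode f σ) (k : ℕ) (t : W2) (hk : σ t k ≠ T3.zer) :
    ∃ j, absW (shiftn (σ t) k) = σ (shiftn t j) := by
  induction k using Nat.strong_induction_on generalizing t with
  | _ k ih =>
    have drop : ∀ d c, 0 < d → d ≤ k → shiftn (σ t) d = signed c (σ (shiftn t 1)) →
        ∃ j, absW (shiftn (σ t) k) = σ (shiftn t j) := by
      intro d c hd hdk heq
      have hshift : shiftn (σ t) k = signed c (shiftn (σ (shiftn t 1)) (k - d)) := by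
        rw [← shiftn_signed, ← heq, shiftn_shiftn, Nat.sub_add_cancel hdk]
      have hne : σ (shiftn t 1) (k - d) ≠ T3.zer := by
        intro h0
        have hval : σ t k = signedLetter c (σ (shiftn t 1) (k - d)) := by
          simpa [shiftn, signed] using congrFun hshift 0
        exact hk (by rw [hval, h0, signedLetter_zer])
      obtain ⟨j, hj⟩ := ih (k - d) (by omega) _ hne
      refine ⟨j + 1, ?_⟩
      rw [hshift, absW_signed, hj, shiftn_shiftn]
      simpa [shiftn] using hne
    rcases k with _ | k
    · exact ⟨0, absW_of_pos (hσ.head t)⟩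
    cases ht : t 0 with
    | false => exact drop 1 (f false) (by omega) (by omega) (hσ.short t ht)
    | true =>
      rcases k with _ | k
      · exact absurd (hσ.sep t ht) hk
      · exact drop 2 (f true) (by omega) (by omega) (hσ.long t ht)

theorem exists_absW_shiftn_eq (hσ : IsSignedCode f σ) (j : ℕ) (t : W2) :
    ∃ k, σ t k ≠ T3.zer ∧ absW (shiftn (σ t) k) = σ (shiftn t j) := by
  induction j generalizing t with
  | zero => exact ⟨0, by simp [hσ.head], absW_of_pos (hσ.head t)⟩
  | succ j ih =>
    obtain ⟨k, hk, hkj⟩ := ih (shiftn t 1)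
    have step : ∀ d c, shiftn (σ t) d = signed c (σ (shiftn t 1)) →
        ∃ k, σ t k ≠ T3.zer ∧ absW (shiftn (σ t) k) = σ (shiftn t (j + 1)) := by
      intro d c heq
      refine ⟨k + d, ?_, ?_⟩
      · have := congrFun heq k
        simp only [shiftn] at this
        rw [this]
        exact signedLetter_ne_zer c hk
      · rw [← shiftn_shiftn, heq, shiftn_signed, absW_signed, hkj, shiftn_shiftn]
        simpa [shiftn] using hk
    cases ht : t 0 with
    | false => exact step 1 _ (hσ.short t ht)
    | true => exact step 2 _ (hσ.long t ht)

theorem isDecodable (hσ : IsSignedCode f σ) (t : W2) : IsDecodable f (σ t) := by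
  refine ⟨hσ.head t, fun k hk => ?_⟩
  obtain ⟨j, hj⟩ := hσ.absW_shiftn_apply k t hk
  exact hj ▸ hσ.isLow _

theorem agree_decode (hσ : IsSignedCode f σ) (n : ℕ) {w : W3} (hw : IsDecodable f w) :
    Agree n w (σ (decode w)) := by
  induction n generalizing w with
  | zero => exact fun i hi => absurd hi (by omega)
  | succ n ih =>
    rintro (_ | i) hi
    · rw [hw.1, hσ.head]
    rcases hw.isLow with ⟨-, h1 | ⟨h1, h2⟩⟩
    · have hne : w 1 ≠ T3.zer := h1 ▸ signedLetter_ne_zer _ (by simp)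
      have hd : dropBlock w = absW (shiftn w 1) := if_neg hne
      have h0 : decode w 0 = false := decide_eq_false hne
      have hag := (ih (hd ▸ hw.absW_shiftn hne)).signed (f false)
      rw [← shiftn_decode, ← hσ.short _ h0, hd, signed_absW (w := shiftn w 1) h1] at hag
      exact hag i (by omega)
    · have h0 : decode w 0 = true := decide_eq_true h1
      rcases i with _ | i
      · rw [hσ.sep _ h0, h1]
      have hne : w 2 ≠ T3.zer := h2 ▸ signedLetter_ne_zer _ (by simp)
      have hd : dropBlock w = absW (shiftn w 2) := if_pos h1
      have hag := (ih (hd ▸ hw.absW_shiftn hne)).signed (f true)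
      rw [← shiftn_decode, ← hσ.long _ h0, hd, signed_absW (w := shiftn w 2) h2] at hag
      exact hag i (by omega)

theorem apply_decode (hσ : IsSignedCode f σ) {w : W3} (hw : IsDecodable f w) :
    σ (decode w) = w :=
  (eq_of_forall_agree fun n => hσ.agree_decode n hw).symm

end IsSignedCode

/-! ### The maps `ρ_0`, `ρ_1`, `ρ_2` and `τ_{0,1}` as signed block codes -/

theorem rhoL_cons (par : List Bool → Bool) (x : Bool) (l : List Bool) :
    rhoL par (x :: l) = rhoImg (par []) x ++ rhoL (fun w => par (x :: w)) l := by
  simp [rhoL, List.ofFn_succ]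

theorem length_le_length_rhoL (par : List Bool → Bool) (l : List Bool) :
    l.length ≤ (rhoL par l).length := by
  induction l generalizing par with
  | nil => simp
  | cons x l ih =>
    have := ih fun w => par (x :: w)
    rw [rhoL_cons]
    simp [rhoImg]
    omega

theorem rhoL_append (par : List Bool → Bool) (l l' : List Bool) :
    rhoL par (l ++ l') = rhoL par l ++ rhoL (fun w => par (l ++ w)) l' := by
  induction l generalizing par with
  | nil => simp [rhoL]
  | cons x l ih => simp [rhoL_cons, ih]

theorem rhoL_xor (c : Bool) (par : List Bool → Bool) (l : List Bool) :
    rhoL (fun w => c ^^ par w) l = (rhoL par l).map (signedLetter c) := by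
  induction l generalizing par with
  | nil => simp [rhoL]
  | cons x l ih =>
    rw [rhoL_cons, rhoL_cons, List.map_append, ih]
    congr 1
    cases c <;> cases par [] <;> cases x <;> rfl

theorem rhoW_xor (c : Bool) (par : List Bool → Bool) (a : W2) :
    rhoW (fun w => c ^^ par w) a = signed c (rhoW par a) := by
  funext n
  rw [rhoW, rhoL_xor, signed, rhoW]
  conv_lhs => rw [← signedLetter_zer c]
  exact List.getD_map _ _ _

theorem ofFn_succ_eq_cons (a : W2) (n : ℕ) : List.ofFn (fun i : Fin (n + 1) => a i.val) =
    a 0 :: List.ofFn (fun i : Fin n => shiftn a 1 i.val) := by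
  rw [List.ofFn_succ]
  rfl

theorem isSignedCode_rhoW {par : List Bool → Bool} {f : Bool → Bool} (hnil : par [] = true)
    (hcons : ∀ x w, par (x :: w) = (f x ^^ par w)) : IsSignedCode f (rhoW par) := by
  have hpar : ∀ x, (fun w => par (x :: w)) = fun w => f x ^^ par w := fun x => funext (hcons x)
  refine ⟨fun t => ?_, fun t h => ?_, fun t h => ?_, fun t h => ?_⟩
  · rw [rhoW, ofFn_succ_eq_cons, rhoL_cons, hnil]
    simp [rhoImg]
  · rw [← rhoW_xor, ← hpar, ← h]
    funext n
    rw [shiftn, rhoW, ofFn_succ_eq_cons, rhoL_cons, h, hnil]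
    simp [rhoImg, rhoW]
  · rw [rhoW, ofFn_succ_eq_cons, rhoL_cons, hnil, h]
    simp [rhoImg]
  · rw [← rhoW_xor, ← hpar, ← h]
    funext n
    rw [shiftn, rhoW, ofFn_succ_eq_cons, rhoL_cons, h, hnil, List.ofFn_succ', List.concat_eq_append,
      rhoL_append]
    simp only [rhoImg, rhoW, if_true, List.cons_append, List.nil_append, List.getD_cons_succ]
    rw [List.getD_append]
    · rfl
    · exact lt_of_lt_of_le (by simp) (length_le_length_rhoL _ _)

theorem subApply3_tau01T_eq_rhoW : subApply3 tau01T = rhoW fun _ => true := by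
  funext a n
  have key : ∀ l : List Bool, (l.map tau01T).flatten = rhoL (fun _ => true) l := by
    intro l
    induction l with
    | nil => simp [rhoL]
    | cons x l ih => cases x <;> simp [rhoL_cons, ih, tau01T, rhoImg]
  rw [subApply3, rhoW, key]

theorem exists_isSignedCode (f : Bool → Bool) : ∃ σ ∈ sigmaSet, IsSignedCode f σ := by
  cases h0 : f false <;> cases h1 : f true
  · refine ⟨_, Or.inr (Or.inr (Or.inr rfl)), ?_⟩
    rw [subApply3_tau01T_eq_rhoW]
    exact isSignedCode_rhoW rfl fun x w => by cases x <;> simp [h0, h1]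
  · exact ⟨_, Or.inr (Or.inl rfl), isSignedCode_rhoW (by simp [par1])
      fun x w => by cases x <;> simp [h0, h1, par1, Nat.even_add_one,
        -Nat.not_even_iff_odd]⟩
  · exact ⟨_, Or.inl rfl, isSignedCode_rhoW (by simp [par0])
      fun x w => by cases x <;> simp [h0, h1, par0, Nat.even_add_one,
        -Nat.not_even_iff_odd]⟩
  · exact ⟨_, Or.inr (Or.inr (Or.inl rfl)), isSignedCode_rhoW (by simp [par2])
      fun x w => by cases x <;> simp [h0, h1, par2, Nat.even_add_one,
        -Nat.not_even_iff_odd]⟩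

/-! ### Consistent orders -/

/-- The order compares words by their first letters as `-1 < 0 < 1`, and the sign changes `f` of a
signed block code are such that this code yields the smallest cylinders among those of words
starting with `1`. -/
structure IsAdapted (f : Bool → Bool) (le : W3 → W3 → Prop) : Prop where
  lt_of_pos (u v : W3) (hu : u 0 ≠ T3.pos) (hv : v 0 = T3.pos) : wlt le u v
  lt_sep (u v : W3) (hu : u 0 = T3.pos) (hv : v 0 = T3.pos)
    (hu' : u 1 = signedLetter (f false) T3.pos) (hv' : v 1 = T3.zer) : wlt le u v
  lt_of_isLow (u v : W3) (hu : IsLow f u) (hv : v 0 = T3.pos) (hv' : ¬ IsLow f v) : wlt le u v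

theorem inCyl_append_singleton {A : Type*} {w : List A} {x : A} {a : ℕ → A} (ha : inCyl w a)
    (hx : a w.length = x) : inCyl (w ++ [x]) a := by
  rintro ⟨i, hi⟩
  rw [List.length_append, List.length_singleton] at hi
  rcases (Nat.lt_succ_iff_lt_or_eq.1 hi) with h | rfl
  · simpa [h] using ha ⟨i, h⟩
  · simpa using hx

theorem inCyl_update {A : Type*} {w : List A} {x : A} {a : ℕ → A} (ha : inCyl w a) :
    inCyl w (Function.update a w.length x) := fun i => by
  rw [Function.update_of_ne i.2.ne]
  exact ha i

theorem IsCylOrder.wlt_trans {A : Type*} [DecidableEq A] {le : (ℕ → A) → (ℕ → A) → Prop}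
    (h : IsCylOrder le) {a b c : ℕ → A} (hab : wlt le a b) (hbc : wlt le b c) : wlt le a c :=
  h.wlt_of_not_le fun hca => h.not_le_of_wlt hab (h.2.2.1 _ _ _ hbc.1 hca)

/-- The letter following the prefix `w` that is the smallest one is `-1` if `c` is true and `1`
otherwise. -/
theorem Consistent.exists_sign {le : W3 → W3 → Prop} (hc : Consistent le) (h : IsCylOrder le)
    (w : List T3) : ∃ c, ∀ u v, inCyl w u → inCyl w v →
      (u w.length = signedLetter c T3.pos ∧ v w.length ≠ signedLetter c T3.pos ∨
        u w.length = T3.zer ∧ v w.length = signedLetter (!c) T3.pos) → wlt le u v := by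
  have key : ∀ c, cylLt le (w ++ [signedLetter c T3.pos]) (w ++ [T3.zer]) →
      cylLt le (w ++ [T3.zer]) (w ++ [signedLetter (!c) T3.pos]) → ∀ u v, inCyl w u → inCyl w v →
      (u w.length = signedLetter c T3.pos ∧ v w.length ≠ signedLetter c T3.pos ∨
        u w.length = T3.zer ∧ v w.length = signedLetter (!c) T3.pos) → wlt le u v := by
    rintro c h₁ h₂ u v hu hv (⟨hux, hvx⟩ | ⟨huz, hvy⟩)
    · have hcases : v w.length = T3.zer ∨ v w.length = signedLetter (!c) T3.pos := by
        cases c <;> cases hval : v w.length <;> simp_all [signedLetter, T3.negT]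
      rcases hcases with hvz | hvy
      · exact h₁ u v (inCyl_append_singleton hu hux) (inCyl_append_singleton hv hvz)
      · have hmid : inCyl (w ++ [T3.zer]) (Function.update v w.length T3.zer) :=
          inCyl_append_singleton (inCyl_update hv) (Function.update_self _ _ _)
        exact h.wlt_trans (h₁ u _ (inCyl_append_singleton hu hux) hmid)
          (h₂ _ v hmid (inCyl_append_singleton hv hvy))
    · exact h₂ u v (inCyl_append_singleton hu huz) (inCyl_append_singleton hv hvy)
  rcases hc w with ⟨h₁, h₂⟩ | ⟨h₁, h₂⟩
  exacts [⟨true, key true h₁ h₂⟩, ⟨false, key false h₁ h₂⟩]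

theorem Consistent.exists_isAdapted {le : W3 → W3 → Prop} (hc : Consistent le)
    (h : IsCylOrder le) (h01 : wlt le zeroW3 oneW3) : ∃ f, IsAdapted f le := by
  obtain ⟨c, hroot⟩ := hc.exists_sign h []
  obtain ⟨d, hone⟩ := hc.exists_sign h [T3.pos]
  obtain ⟨e, hsep⟩ := hc.exists_sign h [T3.pos, T3.zer]
  have hnil : ∀ u : W3, inCyl [] u := fun u i => i.elim0
  have hpos : ∀ u : W3, u 0 = T3.pos → inCyl [T3.pos] u := fun u hu =>
    inCyl_append_singleton (w := []) (hnil u) hu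
  have hpz : ∀ u : W3, u 0 = T3.pos → u 1 = T3.zer → inCyl [T3.pos, T3.zer] u := fun u hu hu' =>
    inCyl_append_singleton (w := [T3.pos]) (hpos u hu) hu'
  have hctrue : c = true := by
    by_contra hcf
    rw [Bool.not_eq_true] at hcf
    subst hcf
    refine h.not_le_of_wlt h01 (hroot oneW3 zeroW3 (hnil _) (hnil _) (Or.inl ⟨rfl, ?_⟩)).1
    simp [zeroW3, signedLetter]
  subst hctrue
  refine ⟨fun b => if b then e else d, fun u v hu hv => ?_, fun u v hu hv hu' hv' => ?_,
    fun u v hu hv hv' => ?_⟩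
  · refine hroot u v (hnil _) (hnil _) ?_
    cases hval : u 0 <;> simp_all [signedLetter, T3.negT]
  · refine hone u v (hpos u hu) (hpos v hv) (Or.inl ⟨hu', ?_⟩)
    exact fun heq => signedLetter_ne_zer d (by simp) (heq.symm.trans hv')
  · simp only [IsLow, hv, true_and, not_or, not_and] at hv'
    obtain ⟨hu0, hu1 | ⟨hu1, hu2⟩⟩ := hu
    · exact hone u v (hpos u hu0) (hpos v hv) (Or.inl ⟨hu1, hv'.1⟩)
    · by_cases hvz : v 1 = T3.zer
      · exact hsep u v (hpz u hu0 hu1) (hpz v hv hvz) (Or.inl ⟨hu2, hv'.2 hvz⟩)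
      · refine hone u v (hpos u hu0) (hpos v hv) (Or.inr ⟨hu1, ?_⟩)
        have hv1 := hv'.1
        change v 1 = _
        cases d <;> cases hval : v 1 <;> simp_all [signedLetter, T3.negT]

/-! ### Sup-words of absolute values -/

section Main

variable {f : Bool → Bool} {σ : W2 → W3} {le : W3 → W3 → Prop}

theorem IsSignedCode.le_of_isSupOf_tails (hσ : IsSignedCode f σ) (h : IsCylOrder le) {t m : W2}
    (hm : IsSupOf (fun a b => le (σ a) (σ b)) (tails t) m) {b : W3}
    (hb : ∀ k, le (σ (shiftn t k)) b) : le (σ m) b := by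
  rcases h.1 (σ m) b with hle | hle
  · exact hle
  have hbm : σ m = b := eq_of_forall_agree fun n => by
    obtain ⟨_, ⟨k, rfl⟩, hk⟩ := exists_agree_of_mem_closure
      ((hσ.isCylOrder h).mem_closure_of_isSupOf (tails_nonempty t) hm) n
    have hag := hσ.agree_apply_of_agree hk
    exact hag.trans (h.agree (hb k) hle hag.symm)
  exact hbm ▸ h.refl _

theorem IsSignedCode.isSupOf_absTails (hσ : IsSignedCode f σ) (h : IsCylOrder le)
    (hf : IsAdapted f le) {t m : W2}
    (hm : IsSupOf (fun a b => le (σ a) (σ b)) (tails t) m) :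
    IsSupOf le (absTails (σ t)) (σ m) := by
  refine ⟨?_, fun b hb => hσ.le_of_isSupOf_tails h hm fun j => ?_⟩
  · rintro _ ⟨k, rfl⟩
    by_cases hk : σ t k = T3.zer
    · refine (hf.lt_of_pos _ _ ?_ (hσ.head m)).1
      rw [absW_apply_zero_of_zer (by simpa [shiftn] using hk)]
      simp
    · obtain ⟨j, hj⟩ := hσ.absW_shiftn_apply k t hk
      exact hj ▸ hm.1 _ ⟨j, rfl⟩
  · obtain ⟨k, -, hk⟩ := hσ.exists_absW_shiftn_eq j t
    exact hk ▸ hb _ ⟨k, rfl⟩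

theorem IsSignedCode.apply_mem_MAbs (hσ : IsSignedCode f σ) (h : IsCylOrder le)
    (hf : IsAdapted f le) {m : W2} (hm : m ∈ supWords fun a b => le (σ a) (σ b)) :
    σ m ∈ MAbs le := by
  obtain ⟨t, ht⟩ := hm
  exact ⟨σ t, hσ.isSupOf_absTails h hf ht⟩

theorem absTails_zeroW3 : absTails zeroW3 = {zeroW3} := by
  ext b
  constructor
  · rintro ⟨k, rfl⟩
    exact absW_zeroW3
  · rintro rfl
    exact ⟨0, absW_zeroW3.symm⟩

theorem zeroW3_mem_MAbs (h : IsCylOrder le) : zeroW3 ∈ MAbs le := by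
  refine ⟨zeroW3, ?_, fun b hb => hb _ ?_⟩
  · rw [absTails_zeroW3]
    rintro _ rfl
    exact h.refl _
  · rw [absTails_zeroW3]
    rfl

theorem absW_shiftn_absW {a : W3} (ha : a 0 ≠ T3.zer) {k : ℕ} (hk : a k ≠ T3.zer) :
    absW (shiftn (absW a) k) = absW (shiftn a k) := by
  rw [absW_of_ne_zer ha, shiftn_signed, absW_signed]
  simpa [shiftn] using hk

theorem eq_zeroW3_or_of_mem_MAbs (hσ : IsSignedCode f σ) (h : IsCylOrder le)
    (hf : IsAdapted f le) {s : W3} (hs : s ∈ MAbs le) :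
    s = zeroW3 ∨ s 0 = T3.pos ∧
      (IsLow f s → ∃ m ∈ supWords fun a b => le (σ a) (σ b), σ m = s) := by
  obtain ⟨a, ha⟩ := hs
  by_cases hex : ∃ k, a k ≠ T3.zer
  swap
  · push Not at hex
    obtain rfl : a = zeroW3 := funext hex
    refine Or.inl (h.2.1 _ _ (ha.2 _ ?_) (ha.1 _ ⟨0, absW_zeroW3.symm⟩))
    rw [absTails_zeroW3]
    rintro _ rfl
    exact h.refl _
  right
  have hpos : s 0 = T3.pos := by
    by_contra hne
    obtain ⟨k, hk⟩ := hex
    refine h.not_le_of_wlt (hf.lt_of_pos s (absW (shiftn a k)) hne ?_) (ha.1 _ ⟨k, rfl⟩)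
    exact absW_apply_zero_of_ne_zer (by simpa [shiftn] using hk)
  refine ⟨hpos, fun hlow => ?_⟩
  have hlow' : ∀ k, a k ≠ T3.zer → IsLow f (absW (shiftn a k)) := by
    intro k hk
    by_contra hnot
    refine h.not_le_of_wlt (hf.lt_of_isLow s (absW (shiftn a k)) hlow ?_ hnot) (ha.1 _ ⟨k, rfl⟩)
    exact absW_apply_zero_of_ne_zer (by simpa [shiftn] using hk)
  obtain ⟨N, hN, hmin⟩ : ∃ N, a N ≠ T3.zer ∧ ∀ k < N, a k = T3.zer :=
    ⟨Nat.find hex, Nat.find_spec hex, fun k hk => not_not.1 (Nat.find_min hex hk)⟩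
  have hN' : shiftn a N 0 ≠ T3.zer := by simpa [shiftn] using hN
  set v := absW (shiftn a N) with hv
  have htail : ∀ k, a (k + N) ≠ T3.zer → absW (shiftn v k) = absW (shiftn a (k + N)) := by
    intro k hk
    rw [hv, absW_shiftn_absW hN' hk, shiftn_shiftn]
  have hzer : ∀ k, v k ≠ T3.zer → a (k + N) ≠ T3.zer := by
    intro k hk h0
    rw [hv, absW_of_ne_zer hN'] at hk
    simp [signed, shiftn, h0, signedLetter_zer] at hk
  have hdec : IsDecodable f v := ⟨absW_apply_zero_of_ne_zer hN', fun k hk => by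
    rw [htail k (hzer k hk)]
    exact hlow' _ (hzer k hk)⟩
  have hvσ := hσ.apply_decode hdec
  obtain ⟨m, -, hm⟩ := (hσ.isCylOrder h).exists_isSupOf (tails_nonempty (decode v))
  refine ⟨m, ⟨_, hm⟩, h.2.1 _ _ (hσ.le_of_isSupOf_tails h hm fun j => ?_) (ha.2 _ ?_)⟩
  · obtain ⟨k, hk, hkj⟩ := hσ.exists_absW_shiftn_eq j (decode v)
    rw [hvσ] at hk hkj
    rw [← hkj, htail k (hzer k hk)]
    exact ha.1 _ ⟨_, rfl⟩
  · rintro _ ⟨k, rfl⟩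
    by_cases hk : a k = T3.zer
    · refine (hf.lt_of_pos _ _ ?_ (hσ.head m)).1
      rw [absW_apply_zero_of_zer (by simpa [shiftn] using hk)]
      simp
    · have hNk : N ≤ k := not_lt.1 fun hlt => hk (hmin k hlt)
      obtain ⟨k, rfl⟩ := Nat.exists_eq_add_of_le' hNk
      rw [← htail k hk]
      exact (hσ.isSupOf_absTails h hf hm).1 _ ⟨k, by rw [hvσ]⟩

theorem IsSignedCode.isDecodable_of_forall_agree (hσ : IsSignedCode f σ) {y : W3}
    (hy : ∀ n, ∃ t, Agree n y (σ t)) : IsDecodable f y := by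
  refine ⟨?_, fun k hk => ?_⟩
  · obtain ⟨t, ht⟩ := hy 1
    exact (ht 0 one_pos).trans (hσ.head t)
  · obtain ⟨t, ht⟩ := hy (3 + k)
    have hyk : shiftn y k 0 ≠ T3.zer := by simpa [shiftn] using hk
    exact ((hσ.isDecodable t).2 k (ht k (by omega) ▸ hk)).congr ((ht.shift k).absW hyk).symm

theorem isSmallestAcc_apply (hσ : IsSignedCode f σ) (h : IsCylOrder le) (hf : IsAdapted f le)
    {m : W2} (hm : IsSmallestAcc (fun a b => le (σ a) (σ b))
      (supWords fun a b => le (σ a) (σ b)) m) : IsSmallestAcc le (MAbs le) (σ m) := by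
  refine ⟨isAccPt'_iff.2 fun n => ?_, fun y hy => ?_⟩
  · obtain ⟨x, hx, hne, hag⟩ := isAccPt'_iff.1 hm.1 n
    exact ⟨σ x, hσ.apply_mem_MAbs h hf hx, hσ.injective.ne hne, hσ.agree_apply_of_agree hag⟩
  · rw [isAccPt'_iff] at hy
    have hpos : y 0 = T3.pos := by
      have hyz : y ≠ zeroW3 := by
        rintro rfl
        obtain ⟨u, hu, hne, hag⟩ := hy 1
        rcases eq_zeroW3_or_of_mem_MAbs hσ h hf hu with rfl | ⟨hu0, -⟩
        · exact hne rfl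
        · have := (hag 0 one_pos).trans hu0
          simp [zeroW3] at this
      obtain ⟨j, hj⟩ := Function.ne_iff.1 hyz
      obtain ⟨u, hu, -, hag⟩ := hy (j + 1)
      rcases eq_zeroW3_or_of_mem_MAbs hσ h hf hu with rfl | ⟨hu0, -⟩
      · exact absurd (hag j j.lt_succ_self) hj
      · exact (hag 0 j.succ_pos).trans hu0
    by_cases hlow : IsLow f y
    swap
    · exact (hf.lt_of_isLow _ _ (hσ.isLow m) hpos hlow).1
    have happrox : ∀ n, ∃ x ∈ supWords (fun a b => le (σ a) (σ b)), σ x ≠ y ∧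
        Agree n y (σ x) := by
      intro n
      obtain ⟨u, hu, hne, hag⟩ := hy (max n 3)
      have hulow := hlow.congr (hag.mono (le_max_right _ _))
      rcases eq_zeroW3_or_of_mem_MAbs hσ h hf hu with rfl | ⟨-, hu'⟩
      · simpa [zeroW3] using hulow.1
      · obtain ⟨x, hx, rfl⟩ := hu' hulow
        exact ⟨x, hx, hne, hag.mono (le_max_left _ _)⟩
    have hdec : IsDecodable f y := hσ.isDecodable_of_forall_agree fun n =>
      (happrox n).imp fun _ hx => hx.2.2
    rw [← hσ.apply_decode hdec]
    refine hm.2 _ (isAccPt'_iff.2 fun n => ?_)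
    obtain ⟨x, hx, hne, hag⟩ := happrox (2 * n + 1)
    refine ⟨x, hx, fun hxy => hne (hxy ▸ hσ.apply_decode hdec), hσ.agree_of_agree_apply ?_⟩
    rw [hσ.apply_decode hdec]
    exact hag.mono (IsSignedCode.prefixLength_le n _)

end Main

/-- Let `≤` be a consistent cylinder order on `{0,±1}^∞` with `0^∞ < 1^∞`.
Then for some `σ ∈ {ρ_0, ρ_1, ρ_2, τ_{0,1}}`, the order `⪯` defined by `a ⪯ b` iff
`σ(a) ≤ σ(b)` is a cylinder order on `{0,1}^∞` with `0^∞ ≺ 1^∞`, `m^abs_≤ = σ(m_⪯)`, and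
`{a ∈ M^abs_≤ : a < m^abs_≤} = {0^∞} ∪ {σ(a) : a ∈ M_⪯, a ≺ m_⪯}`. -/
theorem stmt_15 (le : W3 → W3 → Prop) (h : IsCylOrder le) (hc : Consistent le)
    (h01 : wlt le zeroW3 oneW3) :
    ∃ σ ∈ sigmaSet, ∃ le' : W2 → W2 → Prop,
      le' = (fun a b => le (σ a) (σ b)) ∧
      IsCylOrder le' ∧ wlt le' w0 w1 ∧
      ∃ m' mabs, IsSmallestAcc le' (supWords le') m' ∧
        IsSmallestAcc le (MAbs le) mabs ∧
        mabs = σ m' ∧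
        {a ∈ MAbs le | wlt le a mabs} =
          insert zeroW3 (σ '' {a ∈ supWords le' | wlt le' a m'}) := by
  obtain ⟨f, hf⟩ := hc.exists_isAdapted h h01
  obtain ⟨σ, hmem, hσ⟩ := exists_isSignedCode f
  obtain ⟨m, hm⟩ := (hσ.isCylOrder h).exists_isSmallestAcc
  have h01' : wlt le (σ w0) (σ w1) := by
    refine hf.lt_sep _ _ (hσ.head _) (hσ.head _) ?_ (hσ.sep _ rfl)
    rcases (hσ.isLow w0).2 with h1 | ⟨h1, -⟩
    · exact h1
    · exact absurd ((hσ.apply_one_eq_zer_iff w0).1 h1) (by simp [w0])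
  refine ⟨σ, hmem, _, rfl, hσ.isCylOrder h, ⟨h01'.1, fun he => h01'.2 (congrArg σ he)⟩, m, σ m,
    hm, isSmallestAcc_apply hσ h hf hm, rfl, ?_⟩
  ext s
  constructor
  · rintro ⟨hs, hlt⟩
    rcases eq_zeroW3_or_of_mem_MAbs hσ h hf hs with rfl | ⟨hs0, hs'⟩
    · exact Set.mem_insert _ _
    · by_cases hlow : IsLow f s
      · obtain ⟨x, hx, rfl⟩ := hs' hlow
        exact Or.inr ⟨x, ⟨hx, hlt.1, fun he => hlt.2 (congrArg σ he)⟩, rfl⟩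
      · exact absurd hlt.1 (h.not_le_of_wlt (hf.lt_of_isLow _ _ (hσ.isLow m) hs0 hlow))
  · rintro (rfl | ⟨x, ⟨hx, hlt⟩, rfl⟩)
    · exact ⟨zeroW3_mem_MAbs h, hf.lt_of_pos _ _ (by simp [zeroW3]) (hσ.head m)⟩
    · exact ⟨hσ.apply_mem_MAbs h hf hx, hlt.1, hσ.injective.ne hlt.2⟩
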